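/- arXiv:0806.2272 — 8 statements merged into one kernel-verified Lean document; each statement's English description precedes it below -/
import Mathlib

section
/- Let 𝔤 be a finite-dimensional complex semisimple Lie algebra with Cartan subalgebra 𝔞, root system R and root spaces 𝔤_α, and let d ∈ 𝔞 be such that α(d) ∈ ℤ for every root α ∈ R. Let ψ : 𝔤 → ℂ be the linear form that vanishes on every root space 𝔤_α and whose restriction to 𝔞 equals 2·Σ_{α∈R, α(d)>0} α. Then the skew-symmetric bilinear form ρ(X,Y) := ψ([X,Y]) on 𝔤 has radical {X ∈ 𝔤 : ρ(X,Y) = 0 for all Y ∈ 𝔤} exactly equal to 𝔤₀ := 𝔞 ⊕ ⨁_{α∈R, α(d)=0} 𝔤_α, i.e. the kernel of ρ is the centralizer of d. -/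
section Involution

variable {ι R : Type*} [DecidableEq ι] {s : Finset ι} {σ : ι → ι}

lemma Finset.sum_eq_sum_filter_notMem_of_involutive [AddCommGroup R] [IsAddTorsionFree R]
    {f : ι → R} (hσ : σ.Involutive) (hf : ∀ i, f (σ i) = -f i) :
    ∑ i ∈ s, f i = ∑ i ∈ s with σ i ∉ s, f i := by
  rw [← Finset.sum_filter_add_sum_filter_not s (fun i ↦ σ i ∈ s) f, add_eq_right]
  refine Finset.sum_involution (fun i _ ↦ σ i) (fun i _ ↦ by simp [hf]) (fun i _ hi h ↦ hi ?_)
    (fun i hi ↦ ?_) (fun i _ ↦ hσ i)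
  · exact self_eq_neg.mp (by simpa [h] using hf i)
  · simp only [Finset.mem_filter] at hi ⊢
    exact ⟨hi.2, by simpa [hσ i] using hi.1⟩

end Involution

namespace LieAlgebra.IsKilling

open LieModule Module

variable {K L : Type*} [Field K] [LieRing L] [LieAlgebra K L] [FiniteDimensional K L]
  {H : LieSubalgebra K L} [H.IsCartanSubalgebra]

open scoped Classical in
/-- The roots taking a positive integral value at `d`. -/
noncomputable def positiveRoots (d : H) : Finset (Weight K H L) :=
  {β ∈ H.root | ∃ n : ℤ, 0 < n ∧ β d = n}

lemma mem_positiveRoots {d : H} {β : Weight K H L} :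
    β ∈ positiveRoots d ↔ β.IsNonZero ∧ ∃ n : ℤ, 0 < n ∧ β d = n := by
  simp [positiveRoots]

variable [IsKilling K L] [IsTriangularizable K H L]

/-- A linear form vanishing on the root spaces is represented, through the Killing form, by an
element of the Cartan subalgebra. -/
lemma exists_killingForm_eq_of_forall_rootSpace {ψ : Dual K L}
    (hψ : ∀ α : Weight K H L, α.IsNonZero → ∀ x ∈ rootSpace H (α : H → K), ψ x = 0) :
    ∃ t : H, ∀ x, ψ x = killingForm K L t x := by
  let t : H := (cartanEquivDual H).symm (ψ ∘ₗ H.toSubmodule.subtype)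
  have ht (h : H) : killingForm K L t h = ψ h :=
    LinearMap.BilinForm.apply_toDual_symm_apply (hB := traceForm_cartan_nondegenerate K L H) _ _
  refine ⟨t, fun x ↦ ?_⟩
  suffices LinearMap.eqLocus ψ (killingForm K L t) = ⊤ from
    (LinearMap.mem_eqLocus (f := ψ)).mp (this ▸ Submodule.mem_top : x ∈ _)
  have htop := congrArg LieSubmodule.toSubmodule (cartan_sup_iSup_rootSpace_eq_top (K := K) H)
  rw [LieSubmodule.top_toSubmodule] at htop
  rw [eq_top_iff, ← htop]
  simp only [LieSubmodule.sup_toSubmodule, LieSubmodule.iSup_toSubmodule, sup_le_iff, iSup_le_iff]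
  refine ⟨fun h hh ↦ (ht ⟨h, hh⟩).symm, fun α hα y hy ↦ ?_⟩
  have ht₀ : (t : L) ∈ rootSpace H (0 : H → K) := by simp
  rw [LinearMap.mem_eqLocus, hψ α hα y hy]
  exact (killingForm_apply_eq_zero_of_mem_rootSpace_of_add_ne_zero K L H ht₀ hy
    (by simpa using hα)).symm

variable [CharZero K]

lemma reflectRoot_apply (α β : Weight K H L) (h : H) :
    reflectRoot α β h = β h - β (coroot α) * α h := rfl

lemma reflectRoot_apply_coroot {α : Weight K H L} (hα : α.IsNonZero) (β : Weight K H L) :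
    reflectRoot α β (coroot α) = -β (coroot α) := by
  rw [reflectRoot_apply, root_apply_coroot hα]
  ring

lemma reflectRoot_involutive {α : Weight K H L} (hα : α.IsNonZero) :
    Function.Involutive (reflectRoot α) := by
  intro β
  ext h
  rw [reflectRoot_apply, reflectRoot_apply_coroot hα, reflectRoot_apply]
  ring

lemma isNonZero_reflectRoot_iff {α : Weight K H L} (hα : α.IsNonZero) {β : Weight K H L} :
    (reflectRoot α β).IsNonZero ↔ β.IsNonZero :=
  ⟨fun h ↦ by simpa [reflectRoot_involutive hα β] using reflectRoot_isNonZero α _ h,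
    reflectRoot_isNonZero α β⟩

lemma sum_positiveRoots_apply_coroot_of_apply_eq_zero {d : H} {α : Weight K H L}
    (hα : α.IsNonZero) (hαd : α d = 0) :
    ∑ β ∈ positiveRoots d, β (coroot α) = 0 := by
  classical
  rw [Finset.sum_eq_sum_filter_notMem_of_involutive (reflectRoot_involutive hα)
    (reflectRoot_apply_coroot hα), Finset.filter_false_of_mem, Finset.sum_empty]
  intro β hβ
  rw [mem_positiveRoots] at hβ
  simpa [mem_positiveRoots, isNonZero_reflectRoot_iff hα, reflectRoot_apply, hαd] using hβ

lemma sum_positiveRoots_apply_coroot_ne_zero {d : H} {α : Weight K H L}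
    (hα : α ∈ positiveRoots d) :
    ∑ β ∈ positiveRoots d, β (coroot α) ≠ 0 := by
  classical
  obtain ⟨hα₀, m, hm, hαd⟩ := mem_positiveRoots.mp hα
  rw [Finset.sum_eq_sum_filter_notMem_of_involutive (reflectRoot_involutive hα₀)
    (reflectRoot_apply_coroot hα₀)]
  simp_rw [apply_coroot_eq_cast α]
  rw [← Int.cast_sum, Int.cast_ne_zero]
  refine (Finset.sum_pos (fun β hβ ↦ ?_) ⟨α, ?_⟩).ne'
  · rw [Finset.mem_filter, mem_positiveRoots, mem_positiveRoots,
      isNonZero_reflectRoot_iff hα₀, reflectRoot_apply, apply_coroot_eq_cast α] at hβ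
    obtain ⟨⟨hβ₀, n, hn, hβd⟩, hβ⟩ := hβ
    by_contra! h
    refine hβ ⟨hβ₀, _, ?_, by rw [hβd, hαd, ← Int.cast_mul, ← Int.cast_sub]⟩
    nlinarith
  · rw [Finset.mem_filter]
    refine ⟨hα, fun h ↦ ?_⟩
    obtain ⟨-, n, hn, hαn⟩ := mem_positiveRoots.mp h
    rw [reflectRoot_apply, root_apply_coroot hα₀, hαd] at hαn
    have : m - 2 * m = n := by exact_mod_cast hαn
    lia

lemma sum_positiveRoots_apply_coroot_eq_zero_iff {d : H}
    (hd : ∀ α : Weight K H L, α.IsNonZero → ∃ n : ℤ, α d = n) {α : Weight K H L}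
    (hα : α.IsNonZero) :
    ∑ β ∈ positiveRoots d, β (coroot α) = 0 ↔ α d = 0 := by
  refine ⟨fun h ↦ ?_, sum_positiveRoots_apply_coroot_of_apply_eq_zero hα⟩
  obtain ⟨n, hn⟩ := hd α hα
  rcases lt_trichotomy n 0 with hneg | rfl | hpos
  · have hα' : -α ∈ positiveRoots d :=
      mem_positiveRoots.mpr ⟨hα.neg, -n, by lia, by simp [hn]⟩
    refine absurd ?_ (sum_positiveRoots_apply_coroot_ne_zero hα')
    have (β : Weight K H L) : β (-coroot α) = -β (coroot α) := map_neg (Weight.toLinear K H L β) _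
    simp [this, h]
  · simpa using hn
  · exact absurd h (sum_positiveRoots_apply_coroot_ne_zero (mem_positiveRoots.mpr ⟨hα, n, hpos, hn⟩))

/-- The centralizer of an element of a Cartan subalgebra is the sum of the Cartan subalgebra and
the root spaces of the roots vanishing on this element. -/
lemma setOf_lie_eq_zero_eq_cartan_sup_iSup_rootSpace (t : H) :
    {x : L | ⁅(t : L), x⁆ = 0} =
      ↑(H.toSubmodule ⊔ ⨆ α : {α : Weight K H L // α.IsNonZero ∧ α t = 0},
        (rootSpace H α.1).toSubmodule) := by
  let N : LieSubmodule K H L :=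
    { LinearMap.ker (ad K L t) with
      lie_mem := by
        intro h x hx
        replace hx : ⁅t, x⁆ = 0 := hx
        change ⁅t, ⁅h, x⁆⁆ = 0
        rw [leibniz_lie, hx, lie_zero, add_zero, trivial_lie_zero H H, zero_lie] }
  have hN {x : L} : x ∈ N ↔ ⁅t, x⁆ = 0 := Iff.rfl
  suffices N.toSubmodule = H.toSubmodule ⊔
      ⨆ α : {α : Weight K H L // α.IsNonZero ∧ α t = 0},
        (rootSpace H α.1).toSubmodule by
    rw [← this]
    rfl
  apply le_antisymm
  · rw [eq_iSup_inf_genWeightSpace (N := N), LieSubmodule.iSup_toSubmodule, iSup_le_iff]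
    rintro α x ⟨hxN, hxα⟩
    by_cases hα : α.IsZero
    · refine Submodule.mem_sup_left ?_
      simpa [hα.eq] using hxα
    by_cases hαt : α t = 0
    · exact Submodule.mem_sup_right (Submodule.mem_iSup_of_mem ⟨α, hα, hαt⟩ hxα)
    · have hx : ⁅t, x⁆ = 0 := hxN
      rw [lie_eq_smul_of_mem_rootSpace hxα, smul_eq_zero_iff_right hαt] at hx
      simp [hx]
  · refine sup_le (fun x hx ↦ ?_) (iSup_le fun ⟨α, hα, hαt⟩ x hx ↦ ?_)
    · exact hN.mpr (congrArg Subtype.val (trivial_lie_zero H H t ⟨x, hx⟩))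
    · exact hN.mpr (by rw [lie_eq_smul_of_mem_rootSpace hx, hαt, zero_smul])

lemma killingForm_coroot_eq_zero_iff {α : Weight K H L} (hα : α.IsNonZero) (t : H) :
    killingForm K L t (coroot α) = 0 ↔ α t = 0 := by
  rw [traceForm_comm]
  change traceForm K H L (coroot α) t = 0 ↔ _
  simp [traceForm_coroot, root_apply_cartanEquivDual_symm_ne_zero hα]

end LieAlgebra.IsKilling

open LieAlgebra.IsKilling in
/-- Let `L` be a finite-dimensional complex semisimple Lie algebra with Cartan
subalgebra `H`, roots the nonzero weights `α` of the adjoint action of `H`, with root spaces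
`LieAlgebra.rootSpace H α`, and let `d ∈ H` be such that `α d ∈ ℤ` for every root `α`.
Let `ψ : L → ℂ` be the linear form vanishing on every root space and whose restriction to `H`
equals `2 · Σ_{α root, α d > 0} α`.  Then the radical of the skew-symmetric bilinear form
`ρ (X, Y) := ψ ⁅X, Y⁆` is exactly `𝔤₀ = H ⊕ ⨁_{α root, α d = 0} 𝔤_α`, the centralizer of `d`. -/
theorem radical_koszul_form_eq_centralizer
    (L : Type*) [LieRing L] [LieAlgebra ℂ L] [FiniteDimensional ℂ L]
    [LieAlgebra.IsSemisimple ℂ L]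
    (H : LieSubalgebra ℂ L) [H.IsCartanSubalgebra]
    (d : H)
    (hd : ∀ α : LieModule.Weight ℂ H L, α.IsNonZero → ∃ n : ℤ, α d = n)
    (ψ : Module.Dual ℂ L)
    (hψroot : ∀ α : LieModule.Weight ℂ H L, α.IsNonZero →
      ∀ x ∈ LieAlgebra.rootSpace H (α : H → ℂ), ψ x = 0)
    (hψcartan : ∀ h : H, ψ h =
      2 * ∑ᶠ α : {α : LieModule.Weight ℂ H L // α.IsNonZero ∧ ∃ n : ℤ, 0 < n ∧ α d = n},
        (α : H → ℂ) h) :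
    {X : L | ∀ Y : L, ψ ⁅X, Y⁆ = 0} =
      ↑(H.toSubmodule ⊔
        ⨆ α : {α : LieModule.Weight ℂ H L // α.IsNonZero ∧ α d = 0},
          (LieAlgebra.rootSpace H (α : H → ℂ)).toSubmodule) := by
  obtain ⟨t, ht⟩ := exists_killingForm_eq_of_forall_rootSpace hψroot
  have hzero {α : LieModule.Weight ℂ H L} (hα : α.IsNonZero) : α d = 0 ↔ α t = 0 := by
    classical
    rw [← killingForm_coroot_eq_zero_iff hα t, ← ht, hψcartan, finsum_eq_sum_of_fintype,
      mul_eq_zero_iff_left two_ne_zero, ← sum_positiveRoots_apply_coroot_eq_zero_iff hd hα]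
    exact Eq.congr_left (Finset.sum_subtype (positiveRoots d) (fun _ ↦ mem_positiveRoots)
      (fun β : LieModule.Weight ℂ H L ↦ β (coroot α)))
  have hrad : {X : L | ∀ Y : L, ψ ⁅X, Y⁆ = 0} = {X : L | ⁅(t : L), X⁆ = 0} := by
    ext X
    have hX : (∀ Y, killingForm ℂ L ⁅(t : L), X⁆ Y = 0) ↔ ⁅(t : L), X⁆ = 0 := by
      rw [← Submodule.mem_bot ℂ, ← ker_killingForm_eq_bot ℂ L, LinearMap.mem_ker,
        LinearMap.ext_iff]
      rfl
    simpa [ht, LieModule.traceForm_apply_lie_apply] using hX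
  rw [hrad, setOf_lie_eq_zero_eq_cartan_sup_iSup_rootSpace]
  congr 2
  exact ((Equiv.subtypeEquivRight fun _ ↦ and_congr_right hzero).iSup_congr fun _ ↦ rfl).symm
end

section
/- Let 𝔤 be a finite-dimensional Lie algebra over a field of characteristic zero equipped with a nondegenerate invariant symmetric bilinear form B, let 𝔥 ⊆ 𝔤 be a subalgebra on which B restricts nondegenerately, let 𝔪 = 𝔥^⊥ be the B-orthogonal complement of 𝔥, and let z be an element of the center of 𝔥. Then the skew-symmetric bilinear form ω_z(X,Y) := B(z,[X,Y]) restricted to 𝔪 × 𝔪 is nondegenerate if and only if the centralizer Z_𝔤(z) = {X ∈ 𝔤 : [z,X] = 0} equals 𝔥 (i.e. if and only if z is 𝔥-regular). -/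
/-- If a bilinear form restricts nondegenerately to a finite-dimensional subspace `H`, every vector
differs from an element of `H` by a vector orthogonal to `H`. -/
theorem exists_mem_forall_sub_orthogonal {K V : Type*} [Field K] [AddCommGroup V] [Module K V]
    (B : V →ₗ[K] V →ₗ[K] K) (H : Submodule K V) [FiniteDimensional K H]
    (hBH : ∀ X ∈ H, (∀ Y ∈ H, B X Y = 0) → X = 0) (X : V) :
    ∃ h ∈ H, ∀ Y ∈ H, B (X - h) Y = 0 := by
  let f : H →ₗ[K] Module.Dual K H := B.domRestrict₁₂ H H
  have hinj : Function.Injective f := by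
    rw [injective_iff_map_eq_zero]
    intro a ha
    exact Subtype.ext (hBH a a.2 fun Y hY => LinearMap.congr_fun ha ⟨Y, hY⟩)
  have hsurj : Function.Surjective f :=
    (LinearMap.injective_iff_surjective_of_finrank_eq_finrank
      (Subspace.dual_finrank_eq (K := K) (V := H)).symm).1 hinj
  obtain ⟨h, hh⟩ := hsurj ((B X).domRestrict H)
  refine ⟨h, h.2, fun Y hY => ?_⟩
  have hXY : B h Y = B X Y := LinearMap.congr_fun hh ⟨Y, hY⟩
  rw [map_sub, LinearMap.sub_apply, hXY, sub_self]

/-- Let `L` be a finite-dimensional Lie algebra over a field `K` of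
characteristic zero with a nondegenerate invariant symmetric bilinear form `B`, let `H ⊆ L` be
a subalgebra on which `B` restricts nondegenerately, let `m = H^⊥` be the `B`-orthogonal
complement of `H`, and let `z` be an element of the center of `H`.  Then the skew-symmetric
form `ω_z (X, Y) := B z ⁅X, Y⁆` restricted to `m × m` is nondegenerate if and only if the
centralizer of `z` in `L` equals `H` (i.e. `z` is `H`-regular). -/
theorem omega_z_nondeg_iff_regular
    (K : Type*) [Field K] [CharZero K]
    (L : Type*) [LieRing L] [LieAlgebra K L] [FiniteDimensional K L]
    (B : L →ₗ[K] L →ₗ[K] K)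
    (hsymm : ∀ X Y : L, B X Y = B Y X)
    (hinv : ∀ X Y Z : L, B ⁅X, Y⁆ Z = B X ⁅Y, Z⁆)
    (hnondeg : ∀ X : L, (∀ Y : L, B X Y = 0) → X = 0)
    (H : LieSubalgebra K L)
    (hBH : ∀ X ∈ H, (∀ Y ∈ H, B X Y = 0) → X = 0)
    (m : Set L) (hm : m = {X : L | ∀ Y ∈ H, B X Y = 0})
    (z : L) (hzH : z ∈ H) (hz : ∀ Y ∈ H, ⁅z, Y⁆ = 0) :
    (∀ X ∈ m, (∀ Y ∈ m, B z ⁅X, Y⁆ = 0) → X = 0) ↔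
      {X : L | ⁅z, X⁆ = 0} = (H : Set L) := by
  subst hm
  have lie_eq_zero : ∀ X : L, (∀ Y ∈ {X : L | ∀ Y ∈ H, B X Y = 0}, B z ⁅X, Y⁆ = 0) →
      ⁅z, X⁆ = 0 := by
    intro X hX
    refine hnondeg _ fun W => ?_
    obtain ⟨h, hh, hW⟩ := exists_mem_forall_sub_orthogonal B H.toSubmodule hBH W
    have h₁ : B z ⁅X, h⁆ = 0 := by
      rw [← lie_skew, map_neg, ← hinv, hz h hh, map_zero, LinearMap.zero_apply, neg_zero]
    have h₂ := hX (W - h) hW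
    rwa [lie_sub, map_sub, h₁, sub_zero, ← hinv] at h₂
  constructor
  · intro hω
    refine Set.Subset.antisymm (fun X hX => ?_) hz
    obtain ⟨h, hh, hXh⟩ := exists_mem_forall_sub_orthogonal B H.toSubmodule hBH X
    have hX' : ⁅z, X⁆ = 0 := hX
    have hz' : ⁅z, X - h⁆ = 0 := by rw [lie_sub, hX', hz h hh, sub_zero]
    have hX0 : X - h = 0 := hω _ hXh fun Y _ => by
      rw [← hinv, hz', map_zero, LinearMap.zero_apply]
    rw [sub_eq_zero.1 hX0]
    exact hh
  · intro hreg X hX hωX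
    have hXH : X ∈ (H : Set L) := hreg ▸ lie_eq_zero X hωX
    exact hBH X hXH hX
end

section
/- Let 𝔤 be a finite-dimensional complex semisimple Lie algebra with Cartan subalgebra 𝔞, root system R and root spaces 𝔤_α, and let d ∈ 𝔞 satisfy α(d) ∈ ℤ for every α ∈ R. Let K̃ be the linear endomorphism of 𝔤 which is zero on 𝔞 and on every root space 𝔤_α with α(d) = 0, is the identity on every 𝔤_α with α(d) > 0, and is minus the identity on every 𝔤_α with α(d) < 0. Define ψ(X) := tr_𝔤(K̃ ∘ ad(X) − ad(K̃X)) for X ∈ 𝔤. Then ψ vanishes on every root space 𝔤_α, and for every t ∈ 𝔞 one has ψ(t) = 2·Σ_{α∈R, α(d)>0} α(t). -/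
namespace LieModule

variable {K L M : Type*} [Field K] [LieRing L] [LieAlgebra K L] [LieRing.IsNilpotent L]
  [AddCommGroup M] [Module K M] [LieRingModule L M] [LieModule K L M] [FiniteDimensional K M]
  [IsTriangularizable K L M]

/-- An endomorphism shifting every generalized weight space by a fixed nonzero function is
traceless. -/
lemma trace_eq_zero_of_mapsTo_genWeightSpace_add {α : L → K} (hα : α ≠ 0) {f : Module.End K M}
    (hf : ∀ γ : L → K, Set.MapsTo f (genWeightSpace M γ) (genWeightSpace M (α + γ))) :
    LinearMap.trace K M f = 0 := by
  classical
  have hds := DirectSum.isInternal_submodule_of_iSupIndep_of_iSup_eq_top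
    (LieSubmodule.iSupIndep_toSubmodule.mpr <| iSupIndep_genWeightSpace K L M)
    (LieSubmodule.iSup_toSubmodule_eq_top.mpr <| iSup_genWeightSpace_eq_top K L M)
  exact LinearMap.trace_eq_zero_of_mapsTo_ne hds (α + ·) (fun γ ↦ by simpa using hα) hf

/-- The trace of an endomorphism acting by a scalar on every generalized weight space. -/
lemma trace_eq_sum_finrank_genWeightSpace_mul [Fintype (Weight K L M)] {f : Module.End K M}
    (c : Weight K L M → K) (hf : ∀ χ : Weight K L M, ∀ x ∈ genWeightSpace M χ, f x = c χ • x) :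
    LinearMap.trace K M f = ∑ χ : Weight K L M, Module.finrank K (genWeightSpace M (χ : L → K)) * c χ := by
  classical
  have hds := DirectSum.isInternal_submodule_of_iSupIndep_of_iSup_eq_top
    (LieSubmodule.iSupIndep_toSubmodule.mpr <| iSupIndep_genWeightSpace' K L M)
    (LieSubmodule.iSup_toSubmodule_eq_top.mpr <| iSup_genWeightSpace_eq_top' K L M)
  have hmaps (χ : Weight K L M) : Set.MapsTo f (genWeightSpace M χ).toSubmodule
      (genWeightSpace M χ).toSubmodule := fun x hx ↦ by
    rw [SetLike.mem_coe, hf χ x hx]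
    exact Submodule.smul_mem _ _ hx
  rw [LinearMap.trace_eq_sum_trace_restrict hds hmaps]
  refine Finset.sum_congr rfl fun χ _ ↦ ?_
  have hres : f.restrict (hmaps χ) = c χ • LinearMap.id := by
    ext x
    exact hf χ x x.2
  rw [hres, map_smul, LinearMap.trace_id, smul_eq_mul, mul_comm]
  rfl

end LieModule


/-- Let `L` be a finite-dimensional complex semisimple Lie algebra with
Cartan subalgebra `H`, roots the nonzero weights of the adjoint action of `H` with root spaces
`LieAlgebra.rootSpace H α`, and let `d ∈ H` satisfy `α d ∈ ℤ` for every root `α`.  Let `K̃` be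
the linear endomorphism of `L` vanishing on `H` and on every root space `𝔤_α` with `α d = 0`,
equal to the identity on every `𝔤_α` with `α d > 0` and to minus the identity on every `𝔤_α`
with `α d < 0`.  Define `ψ X := tr (K̃ ∘ ad X − ad (K̃ X))`.  Then `ψ` vanishes on every root
space, and `ψ t = 2 · Σ_{α root, α d > 0} α t` for every `t ∈ H`. -/
theorem koszul_form_of_grading
    (L : Type*) [LieRing L] [LieAlgebra ℂ L] [FiniteDimensional ℂ L]
    [LieAlgebra.IsSemisimple ℂ L]
    (H : LieSubalgebra ℂ L) [H.IsCartanSubalgebra]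
    (d : H)
    (hd : ∀ α : LieModule.Weight ℂ H L, α.IsNonZero → ∃ n : ℤ, α d = n)
    (K : L →ₗ[ℂ] L)
    (hKcartan : ∀ x ∈ H, K x = 0)
    (hKzero : ∀ α : LieModule.Weight ℂ H L, α.IsNonZero → α d = 0 →
      ∀ x ∈ LieAlgebra.rootSpace H (α : H → ℂ), K x = 0)
    (hKpos : ∀ α : LieModule.Weight ℂ H L, α.IsNonZero → (∃ n : ℤ, 0 < n ∧ α d = n) →
      ∀ x ∈ LieAlgebra.rootSpace H (α : H → ℂ), K x = x)
    (hKneg : ∀ α : LieModule.Weight ℂ H L, α.IsNonZero → (∃ n : ℤ, n < 0 ∧ α d = n) →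
      ∀ x ∈ LieAlgebra.rootSpace H (α : H → ℂ), K x = -x)
    (ψ : L → ℂ)
    (hψ : ∀ X : L, ψ X =
      LinearMap.trace ℂ L (K ∘ₗ LieAlgebra.ad ℂ L X - LieAlgebra.ad ℂ L (K X))) :
    (∀ α : LieModule.Weight ℂ H L, α.IsNonZero →
        ∀ x ∈ LieAlgebra.rootSpace H (α : H → ℂ), ψ x = 0) ∧
    (∀ t : H, ψ t =
      2 * ∑ᶠ α : {α : LieModule.Weight ℂ H L // α.IsNonZero ∧ ∃ n : ℤ, 0 < n ∧ α d = n},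
        (α : H → ℂ) t) := by
  have : Fintype (LieModule.Weight ℂ H L) := Fintype.ofFinite _
  classical
  set P : LieModule.Weight ℂ H L → Prop := fun α ↦ α.IsNonZero ∧ ∃ n : ℤ, 0 < n ∧ α d = n with hP
  have hPneg (α : LieModule.Weight ℂ H L) :
      P (-α) ↔ α.IsNonZero ∧ ∃ n : ℤ, n < 0 ∧ α d = n := by
    simp only [hP, LieModule.Weight.isNonZero_neg, LieModule.Weight.coe_neg, Pi.neg_apply]
    refine and_congr_right fun _ ↦ ⟨?_, ?_⟩ <;> rintro ⟨n, hn, h⟩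
    · exact ⟨-n, by lia, by rw [Int.cast_neg, ← h, neg_neg]⟩
    · exact ⟨-n, by lia, by rw [Int.cast_neg, ← h]⟩
  set s : LieModule.Weight ℂ H L → ℂ := fun α ↦
    (if P α then 1 else 0) - (if P (-α) then 1 else 0) with hs
  have hK (α : LieModule.Weight ℂ H L) :
      ∀ x ∈ LieAlgebra.rootSpace H (α : H → ℂ), K x = s α • x := by
    intro x hx
    by_cases h0 : α.IsNonZero
    · obtain ⟨n, hn⟩ := hd α h0
      have hpos : P α ↔ 0 < n := by simpa [hP, hn] using fun _ ↦ h0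
      have hneg : P (-α) ↔ n < 0 := by simpa [hPneg, hn] using fun _ ↦ h0
      rcases lt_trichotomy n 0 with h | h | h
      · simp [hs, hpos, hneg, h, h.not_gt, hKneg α h0 ⟨n, h, hn⟩ x hx]
      · simp [hs, hpos, hneg, h, hKzero α h0 (by simp [hn, h]) x hx]
      · simp [hs, hpos, hneg, h, h.not_gt, hKpos α h0 ⟨n, h, hn⟩ x hx]
    · have hxH : x ∈ H := by
        rw [LieModule.Weight.IsNonZero, not_not] at h0
        rw [h0.eq] at hx
        simpa using hx
      have hs0 : s α = 0 := by simp [hs, hP, h0]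
      rw [hKcartan x hxH, hs0, zero_smul]
  have hKmaps (γ : H → ℂ) :
      Set.MapsTo K (LieAlgebra.rootSpace H γ) (LieAlgebra.rootSpace H γ) := by
    intro x hx
    by_cases hγ : LieAlgebra.rootSpace H γ = ⊥
    · rw [SetLike.mem_coe, hγ, LieSubmodule.mem_bot] at hx
      simp [hx]
    · rw [SetLike.mem_coe, hK ⟨γ, hγ⟩ x hx]
      exact Submodule.smul_mem _ _ hx
  refine ⟨fun α hα x hx ↦ ?_, fun t ↦ ?_⟩
  · have hα0 : (α : H → ℂ) ≠ 0 := hα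
    rw [hψ]
    refine LieModule.trace_eq_zero_of_mapsTo_genWeightSpace_add (L := H) hα0 fun γ y hy ↦ ?_
    exact Submodule.sub_mem _
      (hKmaps _ (LieAlgebra.lie_mem_genWeightSpace_of_mem_genWeightSpace hx hy))
      (LieAlgebra.lie_mem_genWeightSpace_of_mem_genWeightSpace (hKmaps _ hx) hy)
  · have hact (χ : LieModule.Weight ℂ H L) : ∀ x ∈ LieAlgebra.rootSpace H (χ : H → ℂ),
        (K ∘ₗ LieAlgebra.ad ℂ L (t : L) - LieAlgebra.ad ℂ L (K t)) x = (s χ * χ t) • x := by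
      intro x hx
      have htx : ⁅(t : L), x⁆ = χ t • x := LieAlgebra.IsKilling.lie_eq_smul_of_mem_rootSpace hx t
      simp [hKcartan t t.2, htx, hK χ x hx, smul_smul, mul_comm]
    rw [hψ, LieModule.trace_eq_sum_finrank_genWeightSpace_mul _ hact, finsum_eq_sum_of_fintype]
    have hterm (χ : LieModule.Weight ℂ H L) :
        (Module.finrank ℂ (LieAlgebra.rootSpace H (χ : H → ℂ)) : ℂ) * (s χ * χ t) =
          (if P χ then χ t else 0) + (if P (-χ) then (-χ) t else 0) := by
      by_cases h0 : χ.IsNonZero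
      · rw [LieAlgebra.IsKilling.finrank_rootSpace_eq_one χ h0]
        simp only [hs, LieModule.Weight.coe_neg, Pi.neg_apply]
        split_ifs <;> simp
      · simp [hs, hP, h0]
    have hswap : ∑ χ, (if P (-χ) then (-χ) t else 0) = ∑ χ, if P χ then χ t else 0 :=
      Equiv.sum_comp (Equiv.neg _) fun χ : LieModule.Weight ℂ H L ↦ if P χ then χ t else 0
    rw [Finset.sum_congr rfl fun χ _ ↦ hterm χ, Finset.sum_add_distrib, hswap, ← two_mul,
      ← Finset.sum_filter]
    congr 1
    exact Finset.sum_subtype _ (by simp [hP]) _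
end

section
/- Let R be a reduced crystallographic root system in a finite-dimensional real inner product space E, Π a base of R with corresponding positive roots R⁺, and Π = Π⁰ ⊔ Π¹ a partition of the base. Set R₀⁺ = {α ∈ R⁺ : α ∈ span(Π⁰)}, δ = Σ_{α∈R⁺} α, δ₀ = Σ_{α∈R₀⁺} α and ψ = 2(δ − δ₀). Then for every simple root α ∈ Π⁰ one has ⟨ψ, α^∨⟩ = 0, while for every simple root α ∈ Π¹ one has ⟨ψ, α^∨⟩ = 2a_α with a_α = 2 + b_α, where b_α = −⟨δ₀, α^∨⟩ ≥ 0; in particular ⟨ψ, α^∨⟩ ≥ 4 for α ∈ Π¹. -/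
open scoped RealInnerProductSpace

/-- A reduced crystallographic root system in a finite-dimensional real inner product space
`E`, together with a base (system of simple roots). -/
structure ReducedRootSystemWithBase
    (E : Type*) [NormedAddCommGroup E] [InnerProductSpace ℝ E] [FiniteDimensional ℝ E] where
  /-- the set of roots -/
  roots : Finset E
  /-- the base (system of simple roots) -/
  base : Finset E
  base_subset : base ⊆ roots
  ne_zero : ∀ α ∈ roots, α ≠ 0
  spanning : Submodule.span ℝ (roots : Set E) = ⊤
  /-- the root system is reduced -/
  reduced : ∀ α ∈ roots, ∀ c : ℝ, c • α ∈ roots → c = 1 ∨ c = -1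
  /-- the root system is crystallographic: `⟨β, α^∨⟩ = 2(β,α)/(α,α) ∈ ℤ` -/
  crystallographic : ∀ α ∈ roots, ∀ β ∈ roots, ∃ n : ℤ, 2 * ⟪β, α⟫ / ⟪α, α⟫ = n
  /-- the set of roots is stable under root reflections -/
  reflect_mem : ∀ α ∈ roots, ∀ β ∈ roots, β - (2 * ⟪β, α⟫ / ⟪α, α⟫) • α ∈ roots
  base_indep : LinearIndependent ℝ (fun i : base => (i : E))
  /-- every root is an integral linear combination of simple roots, with coefficients either
  all nonnegative or all nonpositive -/
  base_gen : ∀ β ∈ roots, ∃ c : base → ℤ,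
    ((∀ i, 0 ≤ c i) ∨ (∀ i, c i ≤ 0)) ∧ β = ∑ i : base, (c i : ℝ) • (i : E)

/-- A positive root: a root which is a nonnegative combination of simple roots. -/
def ReducedRootSystemWithBase.IsPositive
    {E : Type*} [NormedAddCommGroup E] [InnerProductSpace ℝ E] [FiniteDimensional ℝ E]
    (P : ReducedRootSystemWithBase E) (β : E) : Prop :=
  β ∈ P.roots ∧ ∃ c : P.base → ℤ, (∀ i, 0 ≤ c i) ∧ β = ∑ i : P.base, (c i : ℝ) • (i : E)

namespace ReducedRootSystemWithBase

variable {E : Type*} [NormedAddCommGroup E] [InnerProductSpace ℝ E] [FiniteDimensional ℝ E]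
  (P : ReducedRootSystemWithBase E)

lemma top_le_span_base : ⊤ ≤ Submodule.span ℝ (Set.range fun i : P.base => (i : E)) := by
  rw [← P.spanning, Submodule.span_le]
  intro β hβ
  obtain ⟨c, -, rfl⟩ := P.base_gen β hβ
  exact Submodule.sum_mem _ fun i _ =>
    Submodule.smul_mem _ _ (Submodule.subset_span ⟨i, rfl⟩)

/-- The simple roots as a basis of the ambient space. -/
noncomputable def simpleBasis : Module.Basis P.base ℝ E :=
  Module.Basis.mk P.base_indep P.top_le_span_base

lemma simpleBasis_apply (i : P.base) : P.simpleBasis i = i := by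
  simp [simpleBasis]

lemma coord_sum (c : P.base → ℤ) (j : P.base) :
    P.simpleBasis.coord j (∑ i : P.base, (c i : ℝ) • (i : E)) = c j := by
  simp_rw [← P.simpleBasis_apply, Module.Basis.coord_apply]
  rw [P.simpleBasis.repr_sum_self fun i => (c i : ℝ)]

lemma coord_simple_of_ne {i j : P.base} (h : i ≠ j) : P.simpleBasis.coord j (i : E) = 0 := by
  rw [← P.simpleBasis_apply i, Module.Basis.coord_apply, Module.Basis.repr_self,
    Finsupp.single_eq_of_ne h.symm]

lemma coord_simple_self (i : P.base) : P.simpleBasis.coord i (i : E) = 1 := by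
  rw [← P.simpleBasis_apply i, Module.Basis.coord_apply, Module.Basis.repr_self,
    Finsupp.single_eq_same]

variable {P}

lemma IsPositive.coord_nonneg {β : E} (h : P.IsPositive β) (j : P.base) :
    0 ≤ P.simpleBasis.coord j β := by
  obtain ⟨-, c, hc, rfl⟩ := h
  rw [coord_sum]
  exact_mod_cast hc j

lemma isPositive_of_coord_pos {β : E} (h : β ∈ P.roots) {j : P.base}
    (hj : 0 < P.simpleBasis.coord j β) : P.IsPositive β := by
  obtain ⟨c, hc | hc, rfl⟩ := P.base_gen β h
  · exact ⟨h, c, hc, rfl⟩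
  · rw [coord_sum] at hj
    exact absurd (hc j) (not_le.2 (by exact_mod_cast hj))

lemma isPositive_simple (i : P.base) : P.IsPositive (i : E) :=
  isPositive_of_coord_pos (P.base_subset i.2) (j := i) (by rw [coord_simple_self]; norm_num)

lemma IsPositive.exists_coord_pos {β : E} (h : P.IsPositive β) {i : P.base} (hne : β ≠ i) :
    ∃ j ≠ i, 0 < P.simpleBasis.coord j β := by
  by_contra! H
  have hzero : ∀ j ≠ i, P.simpleBasis.coord j β = 0 := fun j hj =>
    le_antisymm (H j hj) (h.coord_nonneg j)
  have hβ : β = P.simpleBasis.coord i β • (i : E) := by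
    conv_lhs => rw [← P.simpleBasis.sum_repr β]
    rw [Finset.sum_eq_single i]
    · rw [simpleBasis_apply, Module.Basis.coord_apply]
    · intro j _ hj
      rw [← Module.Basis.coord_apply, hzero j hj, zero_smul]
    · simp
  have hroot := h.1
  rw [hβ] at hroot
  rcases P.reduced i (P.base_subset i.2) _ hroot with h1 | h1
  · rw [h1, one_smul] at hβ
    exact hne hβ
  · linarith [h.coord_nonneg i]

/-- The reflection in a simple root permutes the other positive roots. -/
lemma IsPositive.reflect {β : E} (h : P.IsPositive β) {i : P.base} (hne : β ≠ i) :
    P.IsPositive (β - (2 * ⟪β, (i : E)⟫ / ⟪(i : E), (i : E)⟫) • (i : E)) ∧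
      β - (2 * ⟪β, (i : E)⟫ / ⟪(i : E), (i : E)⟫) • (i : E) ≠ i := by
  obtain ⟨j, hj, hpos⟩ := h.exists_coord_pos hne
  have hcoord : P.simpleBasis.coord j
      (β - (2 * ⟪β, (i : E)⟫ / ⟪(i : E), (i : E)⟫) • (i : E)) = P.simpleBasis.coord j β := by
    rw [map_sub, map_smul, coord_simple_of_ne P hj.symm, smul_zero, sub_zero]
  refine ⟨isPositive_of_coord_pos (P.reflect_mem _ (P.base_subset i.2) _ h.1)
    (hcoord ▸ hpos), fun heq => ?_⟩
  rw [heq, coord_simple_of_ne P hj.symm] at hcoord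
  exact hpos.ne hcoord

lemma inner_simple_pos (i : P.base) : 0 < ⟪(i : E), (i : E)⟫ :=
  real_inner_self_pos.2 (P.ne_zero _ (P.base_subset i.2))

/-- A sum of positive roots over a set containing the simple root `i`, whose other elements are
permuted by the reflection in `i`, pairs with the coroot of `i` to `2`. -/
lemma pairing_sum_eq_two (i : P.base) (A : Finset E) (hi : (i : E) ∈ A)
    (hA : ∀ β ∈ A, P.IsPositive β)
    (hrefl : ∀ β ∈ A, β ≠ i →
      β - (2 * ⟪β, (i : E)⟫ / ⟪(i : E), (i : E)⟫) • (i : E) ∈ A) :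
    2 * ⟪∑ β ∈ A, β, (i : E)⟫ / ⟪(i : E), (i : E)⟫ = 2 := by
  classical
  have hii := inner_simple_pos i
  have hflip (β : E) : ⟪β - (2 * ⟪β, (i : E)⟫ / ⟪(i : E), (i : E)⟫) • (i : E), (i : E)⟫ =
      -⟪β, (i : E)⟫ := by
    rw [inner_sub_left, real_inner_smul_left, div_mul_cancel₀ _ hii.ne']
    ring
  have hzero : ∑ β ∈ A.erase (i : E), ⟪β, (i : E)⟫ = 0 := by
    refine Finset.sum_involution
      (fun β _ => β - (2 * ⟪β, (i : E)⟫ / ⟪(i : E), (i : E)⟫) • (i : E)) ?_ ?_ ?_ ?_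
    · intro β _
      rw [hflip, add_neg_cancel]
    · intro β _ hne heq
      have := hflip β
      rw [heq] at this
      exact hne (by linarith)
    · intro β hβ
      rw [Finset.mem_erase] at hβ ⊢
      exact ⟨((hA β hβ.2).reflect hβ.1).2, hrefl β hβ.2 hβ.1⟩
    · intro β _
      rw [hflip, mul_neg, neg_div, neg_smul, sub_neg_eq_add, sub_add_cancel]
  rw [sum_inner, ← Finset.add_sum_erase A _ hi, hzero, add_zero, mul_div_assoc,
    div_self hii.ne', mul_one]

lemma coord_eq_zero_of_mem_span {B : Finset E} (hB : B ⊆ P.base) {i : P.base} (hi : (i : E) ∉ B)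
    {β : E} (hβ : β ∈ Submodule.span ℝ (B : Set E)) : P.simpleBasis.coord i β = 0 := by
  have hle : Submodule.span ℝ (B : Set E) ≤ LinearMap.ker (P.simpleBasis.coord i) := by
    rw [Submodule.span_le]
    intro γ hγ
    have hne : (⟨γ, hB hγ⟩ : P.base) ≠ i := by
      rintro rfl
      exact hi hγ
    exact coord_simple_of_ne P hne
  exact hle hβ

lemma IsPositive.inner_nonpos {β : E} (h : P.IsPositive β) {i : P.base}
    (hi : P.simpleBasis.coord i β = 0) : ⟪β, (i : E)⟫ ≤ 0 := by
  have hne : β ≠ i := by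
    rintro rfl
    rw [coord_simple_self] at hi
    exact one_ne_zero hi
  have hc := (h.reflect hne).1.coord_nonneg i
  rw [map_sub, map_smul, hi, coord_simple_self, smul_eq_mul, mul_one, zero_sub,
    Left.nonneg_neg_iff, div_le_iff₀ (inner_simple_pos i)] at hc
  linarith

lemma finite_isPositive : {β : E | P.IsPositive β}.Finite :=
  P.roots.finite_toSet.subset fun _ h => h.1

end ReducedRootSystemWithBase

/-- Let `R` be a reduced crystallographic root system in a
finite-dimensional real inner product space `E`, `Π` a base with positive roots `R⁺`, and
`Π = Π⁰ ⊔ Π¹` a partition of the base.  Set `R₀⁺ = {α ∈ R⁺ : α ∈ span Π⁰}`,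
`δ = Σ_{α ∈ R⁺} α`, `δ₀ = Σ_{α ∈ R₀⁺} α` and `ψ = 2(δ − δ₀)`.  Then `⟨ψ, α^∨⟩ = 0` for
every `α ∈ Π⁰`, while for `α ∈ Π¹` one has `⟨ψ, α^∨⟩ = 2 a_α` with `a_α = 2 + b_α`,
`b_α = −⟨δ₀, α^∨⟩ ≥ 0`; in particular `⟨ψ, α^∨⟩ ≥ 4` for `α ∈ Π¹`. -/
theorem koszul_form_coefficients
    (E : Type*) [NormedAddCommGroup E] [InnerProductSpace ℝ E] [FiniteDimensional ℝ E]
    (P : ReducedRootSystemWithBase E)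
    (B₀ : Finset E) (hB₀ : B₀ ⊆ P.base)
    (δ δ₀ ψ : E)
    (hδ : δ = ∑ᶠ β ∈ {β : E | P.IsPositive β}, β)
    (hδ₀ : δ₀ = ∑ᶠ β ∈ {β : E | P.IsPositive β ∧ β ∈ Submodule.span ℝ (B₀ : Set E)}, β)
    (hψ : ψ = (2 : ℝ) • (δ - δ₀)) :
    (∀ α ∈ B₀, 2 * ⟪ψ, α⟫ / ⟪α, α⟫ = 0) ∧
    (∀ α ∈ P.base, α ∉ B₀ →
      0 ≤ -(2 * ⟪δ₀, α⟫ / ⟪α, α⟫) ∧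
      2 * ⟪ψ, α⟫ / ⟪α, α⟫ = 2 * (2 + -(2 * ⟪δ₀, α⟫ / ⟪α, α⟫)) ∧
      4 ≤ 2 * ⟪ψ, α⟫ / ⟪α, α⟫) := by
  have hfin := P.finite_isPositive
  have hfin₀ : {β : E | P.IsPositive β ∧ β ∈ Submodule.span ℝ (B₀ : Set E)}.Finite :=
    hfin.subset fun _ h => h.1
  rw [finsum_mem_eq_finite_toFinset_sum _ hfin] at hδ
  rw [finsum_mem_eq_finite_toFinset_sum _ hfin₀] at hδ₀
  have hpair (i : P.base) : 2 * ⟪δ, (i : E)⟫ / ⟪(i : E), (i : E)⟫ = 2 := by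
    rw [hδ]
    refine P.pairing_sum_eq_two i _ ?_ ?_ ?_
    · simpa using P.isPositive_simple i
    · simp
    · simp only [Set.Finite.mem_toFinset, Set.mem_ofPred_eq]
      exact fun β hβ hne => (hβ.reflect hne).1
  have hψ_pair (α : E) : 2 * ⟪ψ, α⟫ / ⟪α, α⟫ =
      2 * (2 * ⟪δ, α⟫ / ⟪α, α⟫ - 2 * ⟪δ₀, α⟫ / ⟪α, α⟫) := by
    rw [hψ, real_inner_smul_left, inner_sub_left]
    ring
  constructor
  · intro α hα
    have hpair₀ : 2 * ⟪δ₀, α⟫ / ⟪α, α⟫ = 2 := by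
      rw [hδ₀]
      refine P.pairing_sum_eq_two ⟨α, hB₀ hα⟩ _ ?_ ?_ ?_
      · simpa using ⟨P.isPositive_simple ⟨α, hB₀ hα⟩, Submodule.subset_span hα⟩
      · simp only [Set.Finite.mem_toFinset, Set.mem_ofPred_eq]
        exact fun β hβ => hβ.1
      · simp only [Set.Finite.mem_toFinset, Set.mem_ofPred_eq]
        exact fun β hβ hne => ⟨(hβ.1.reflect (i := ⟨α, hB₀ hα⟩) hne).1,
          Submodule.sub_mem _ hβ.2 (Submodule.smul_mem _ _ (Submodule.subset_span hα))⟩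
    rw [hψ_pair, hpair ⟨α, hB₀ hα⟩, hpair₀, sub_self, mul_zero]
  · intro α hα hα₀
    have hnonpos : ⟪δ₀, α⟫ ≤ 0 := by
      rw [hδ₀, sum_inner]
      refine Finset.sum_nonpos fun β hβ => ?_
      rw [Set.Finite.mem_toFinset] at hβ
      exact hβ.1.inner_nonpos (i := ⟨α, hα⟩) (P.coord_eq_zero_of_mem_span hB₀ hα₀ hβ.2)
    have hb : 2 * ⟪δ₀, α⟫ / ⟪α, α⟫ ≤ 0 :=
      div_nonpos_of_nonpos_of_nonneg (by linarith) real_inner_self_nonneg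
    rw [hψ_pair, hpair ⟨α, hα⟩]
    exact ⟨by linarith, by ring, by linarith⟩
end

section
/- Let 𝔤 be a finite-dimensional complex semisimple Lie algebra with Cartan subalgebra 𝔞, root system R with root spaces 𝔤_α, and let Π be a base of R. Suppose d ∈ 𝔞 satisfies α_i(d) ∈ {0,1} for every simple root α_i ∈ Π. Define 𝔤_p = ⨁_{α∈R, α(d)=p} 𝔤_α for every nonzero integer p and 𝔤₀ = 𝔞 ⊕ ⨁_{α∈R, α(d)=0} 𝔤_α. Then 𝔤 = ⨁_{p∈ℤ} 𝔤_p is a ℤ-gradation of 𝔤, i.e. [𝔤_p, 𝔤_q] ⊆ 𝔤_{p+q} for all p,q ∈ ℤ, and this gradation is fundamental: for every integer p ≥ 1 one has 𝔤_{p+1} = [𝔤_1, 𝔤_p] and 𝔤_{−p−1} = [𝔤_{−1}, 𝔤_{−p}]. -/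
/-- The graded piece `𝔤_p` of the gradation of a Lie algebra `L` determined by an element
`d` of a Cartan subalgebra `H`: for `p ≠ 0` it is `⨁_{α root, α d = p} 𝔤_α`, and for `p = 0`
it is `H ⊕ ⨁_{α root, α d = 0} 𝔤_α`. -/
noncomputable def gradePiece (L : Type*) [LieRing L] [LieAlgebra ℂ L]
    (H : LieSubalgebra ℂ L) [H.IsCartanSubalgebra] (d : H) (p : ℤ) : Submodule ℂ L :=
  (if p = 0 then H.toSubmodule else ⊥) ⊔
    ⨆ α : {α : LieModule.Weight ℂ H L // α.IsNonZero ∧ α d = (p : ℂ)},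
      (LieAlgebra.rootSpace H (α : H → ℂ)).toSubmodule

namespace LieAlgebra.IsKilling

open LieModule Module

variable {K L : Type*} [Field K] [CharZero K] [LieRing L] [LieAlgebra K L]
  [IsKilling K L] [FiniteDimensional K L]
  {H : LieSubalgebra K L} [H.IsCartanSubalgebra] [IsTriangularizable K H L]

/-- If `γ` and `γ - α` both belong to the `α`-chain through the root `γ`, then every root vector
of weight `γ` is the bracket of a root vector of weight `α` and one of weight `γ - α`. -/
lemma exists_lie_eq_of_one_le_chainBotCoeff {α γ : Weight K H L} (hα : α.IsNonZero)
    (hγ : γ.IsNonZero) (h : 1 ≤ chainBotCoeff α γ) {z : L} (hz : z ∈ rootSpace H γ) :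
    ∃ e ∈ rootSpace H α, ∃ y ∈ rootSpace H (-⇑α + ⇑γ), ⁅e, y⁆ = z := by
  obtain ⟨v, hv, hv₀⟩ := (chainTop α γ).exists_ne_zero
  obtain ⟨_, e, f, isSl2, he, hf⟩ := exists_isSl2Triple_of_weight_isNonZero hα
  obtain rfl := isSl2.h_eq_coroot hα he hf
  have prim : isSl2.HasPrimitiveVectorWith v (chainLength α γ : K) :=
    have := lie_mem_genWeightSpace_of_mem_genWeightSpace he hv
    ⟨hv₀, (chainLength_smul _ _ hv).symm, by rwa [genWeightSpace_add_chainTop _ _ hα] at this⟩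
  set k := chainTopCoeff α γ with hk
  have hlen : k + 1 ≤ chainLength α γ := by
    rw [← chainBotCoeff_add_chainTopCoeff]; lia
  set w := ((toEnd K L L f) ^ k) v with hw
  have hw₀ : w ≠ 0 := prim.pow_toEnd_f_ne_zero_of_eq_nat rfl (by lia)
  have hwγ : w ∈ rootSpace H γ := by
    convert! toEnd_pow_apply_mem hf hv k using 2
    rw [coe_chainTop', ← hk, smul_neg, neg_add_cancel_left]
  have hfw : ⁅f, w⁆ ∈ rootSpace H (-⇑α + ⇑γ) :=
    lie_mem_genWeightSpace_of_mem_genWeightSpace hf hwγ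
  have hefw : ⁅e, ⁅f, w⁆⁆ = ((k + 1) * ((chainLength α γ : K) - k)) • w := by
    rw [hw, prim.lie_f_pow_toEnd_f, prim.lie_e_pow_succ_toEnd_f]
  have hne : ((k + 1) * ((chainLength α γ : K) - k)) ≠ 0 := by
    refine mul_ne_zero (Nat.cast_add_one_ne_zero k) (sub_ne_zero.mpr ?_)
    exact_mod_cast (by lia : chainLength α γ ≠ k)
  obtain ⟨c, hc⟩ : ∃ c : K, c • w = z := by
    simpa using (finrank_eq_one_iff_of_nonzero' (⟨w, hwγ⟩ : rootSpace H γ) (by simpa using hw₀)).mp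
      (finrank_rootSpace_eq_one γ hγ) ⟨z, hz⟩
  refine ⟨e, he, (c * ((k + 1) * ((chainLength α γ : K) - k))⁻¹) • ⁅f, w⁆,
    (rootSpace H _).smul_mem _ hfw, ?_⟩
  rw [lie_smul, hefw, smul_smul, mul_assoc, inv_mul_cancel₀ hne, mul_one, hc]

/-- If a root `γ` is a nonnegative integral combination of roots, then `γ - α i` is a root or zero
for some `α i` which occurs in the combination. -/
lemma exists_one_le_chainBotCoeff_of_eq_sum {ι : Type*} [Fintype ι] {a : ι → Weight K H L}
    (ha : ∀ i, (a i).IsNonZero) {γ : Weight K H L} (hγ : γ.IsNonZero) (c : ι → ℕ)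
    (hc : ∀ h, γ h = ∑ i, (c i : K) * a i h) :
    ∃ i, 0 < c i ∧ 1 ≤ chainBotCoeff (a i) γ := by
  have key (i : ι) (hi : 1 ≤ (chainBotCoeff γ (a i) - chainTopCoeff γ (a i) : ℤ)) :
      1 ≤ chainBotCoeff (a i) γ := by
    let P := rootSystem H
    let i' : H.root := ⟨a i, by simpa using ha i⟩
    let j' : H.root := ⟨γ, by simpa using hγ⟩
    have h₁ : P.pairingIn ℤ i' j' = chainBotCoeff γ (a i) - chainTopCoeff γ (a i) := by
      apply Int.cast_injective (α := K)
      rw [← apply_coroot_eq_cast]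
      exact P.algebraMap_pairingIn ℤ i' j'
    have h₂ : P.pairingIn ℤ j' i' = chainBotCoeff (a i) γ - chainTopCoeff (a i) γ := by
      apply Int.cast_injective (α := K)
      rw [← apply_coroot_eq_cast]
      exact P.algebraMap_pairingIn ℤ j' i'
    have := (P.zero_lt_pairingIn_iff' ℤ (i := i') (j := j')).mp (by lia)
    lia
  by_contra! hcon
  have h2 := hc (coroot γ)
  simp only [root_apply_coroot hγ, apply_coroot_eq_cast] at h2
  norm_cast at h2
  have : ∑ i, (c i : ℤ) * (chainBotCoeff γ (a i) - chainTopCoeff γ (a i) : ℤ) ≤ 0 := by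
    refine Finset.sum_nonpos fun i _ ↦ ?_
    rcases (c i).eq_zero_or_pos with h0 | h0
    · simp [h0]
    · refine mul_nonpos_of_nonneg_of_nonpos (by positivity) ?_
      by_contra! hlt
      exact (hcon i h0).not_ge (key i hlt)
  lia

end LieAlgebra.IsKilling

namespace gradePiece

open LieModule LieAlgebra LieAlgebra.IsKilling

variable {L : Type*} [LieRing L] [LieAlgebra ℂ L] [FiniteDimensional ℂ L]
  {H : LieSubalgebra ℂ L} [H.IsCartanSubalgebra] {d : H}

lemma rootSpace_le {χ : H → ℂ} {p : ℤ} (hχ : χ d = p) :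
    (rootSpace H χ).toSubmodule ≤ gradePiece L H d p := by
  rcases eq_or_ne χ 0 with rfl | h0
  · have hp : p = 0 := by simpa using hχ.symm
    rw [gradePiece, if_pos hp]
    refine le_sup_of_le_left ?_
    rw [rootSpace_zero_eq]
    rfl
  · by_cases hbot : rootSpace H χ = ⊥
    · simp [hbot]
    · refine le_sup_of_le_right ?_
      exact le_iSup (fun α : {α : Weight ℂ H L // α.IsNonZero ∧ α d = (p : ℂ)} ↦
        (rootSpace H (α : H → ℂ)).toSubmodule) ⟨⟨χ, hbot⟩, h0, hχ⟩

lemma eq_iSup_rootSpace (p : ℤ) :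
    gradePiece L H d p = ⨆ χ : {χ : H → ℂ // χ d = p}, (rootSpace H χ.1).toSubmodule := by
  refine le_antisymm (sup_le ?_ (iSup_le fun α ↦ ?_)) (iSup_le fun χ ↦ rootSpace_le χ.2)
  · split_ifs with hp
    · refine le_iSup_of_le ⟨0, by simp [hp]⟩ ?_
      rw [rootSpace_zero_eq]
      rfl
    · exact bot_le
  · exact le_iSup_of_le ⟨α, α.2.2⟩ le_rfl

lemma lie_mem {p q : ℤ} {x y : L} (hx : x ∈ gradePiece L H d p) (hy : y ∈ gradePiece L H d q) :
    ⁅x, y⁆ ∈ gradePiece L H d (p + q) := by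
  rw [eq_iSup_rootSpace] at hx hy
  induction hx using Submodule.iSup_induction' with
  | zero => simp
  | add x₁ x₂ _ _ h₁ h₂ => rw [add_lie]; exact add_mem h₁ h₂
  | mem χ x hx =>
    induction hy using Submodule.iSup_induction' with
    | zero => simp
    | add y₁ y₂ _ _ h₁ h₂ => rw [lie_add]; exact add_mem h₁ h₂
    | mem ψ y hy =>
      exact rootSpace_le (by simp [χ.2, ψ.2]) (lie_mem_genWeightSpace_of_mem_genWeightSpace hx hy)

variable (d) in
/-- The span of the brackets of elements of degree `p` and of degree `q`. -/
def lieSpan (p q : ℤ) : Submodule ℂ L :=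
  Submodule.span ℂ {z : L | ∃ x ∈ gradePiece L H d p, ∃ y ∈ gradePiece L H d q, z = ⁅x, y⁆}

lemma lie_mem_lieSpan {p q : ℤ} {x z : L} (hx : x ∈ gradePiece L H d 0)
    (hz : z ∈ lieSpan d p q) : ⁅x, z⁆ ∈ lieSpan d p q := by
  induction hz using Submodule.span_induction with
  | zero => simp
  | add z₁ z₂ _ _ h₁ h₂ => rw [lie_add]; exact add_mem h₁ h₂
  | smul t z _ h => rw [lie_smul]; exact Submodule.smul_mem _ t h
  | mem z hz =>
    obtain ⟨u, hu, v, hv, rfl⟩ := hz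
    rw [leibniz_lie]
    refine add_mem (Submodule.subset_span ⟨_, ?_, v, hv, rfl⟩)
      (Submodule.subset_span ⟨u, hu, _, ?_, rfl⟩)
    · simpa using lie_mem hx hu
    · simpa using lie_mem hx hv

lemma lieSpan_le (p q : ℤ) : lieSpan d p q ≤ gradePiece L H d (p + q) := by
  refine Submodule.span_le.mpr ?_
  rintro _ ⟨x, hx, y, hy, rfl⟩
  exact lie_mem hx hy

variable [IsKilling ℂ L]

lemma le_eigenspace (p : ℤ) :
    gradePiece L H d p ≤ Module.End.eigenspace (ad ℂ L (d : L)) (p : ℂ) := by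
  rw [eq_iSup_rootSpace]
  refine iSup_le fun χ x hx ↦ ?_
  rw [Module.End.mem_eigenspace_iff, ad_apply, ← χ.2]
  exact lie_eq_smul_of_mem_rootSpace hx d

lemma isInternal (h : ∀ α : Weight ℂ H L, α.IsNonZero → ∃ p : ℤ, α d = p) :
    DirectSum.IsInternal (gradePiece L H d) := by
  refine DirectSum.isInternal_submodule_of_iSupIndep_of_iSup_eq_top ?_ ?_
  · exact ((Module.End.eigenspaces_iSupIndep (ad ℂ L (d : L))).comp
      (Int.cast_injective (α := ℂ))).mono le_eigenspace
  · have := congrArg LieSubmodule.toSubmodule (iSup_genWeightSpace_eq_top' ℂ H L)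
    rw [LieSubmodule.iSup_toSubmodule, LieSubmodule.top_toSubmodule] at this
    rw [eq_top_iff, ← this]
    refine iSup_le fun α ↦ ?_
    by_cases hα : α.IsZero
    · exact le_iSup_of_le 0 (rootSpace_le (by simp [hα.eq]))
    · obtain ⟨p, hp⟩ := h α hα
      exact le_iSup_of_le p (rootSpace_le hp)

lemma rootSpace_le_lieSpan {ι : Type*} [Fintype ι] {a : ι → Weight ℂ H L}
    (ha : ∀ i, (a i).IsNonZero) {s p : ℤ} (hp : s + p ≠ 0)
    (had : ∀ i, a i d = 0 ∨ a i d = s) (n : ℕ) (c : ι → ℕ) (hn : ∑ i, c i = n)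
    (γ : Weight ℂ H L) (hγ : γ d = (s + p : ℤ)) (hc : ∀ h, γ h = ∑ i, (c i : ℂ) * a i h) :
    (rootSpace H γ).toSubmodule ≤ lieSpan d s p := by
  classical
  induction n generalizing c γ with
  | zero =>
    have hc0 : ∀ i, c i = 0 := by simpa using hn
    refine absurd ?_ hp
    have h0 : ((s + p : ℤ) : ℂ) = 0 := by
      rw [← hγ, hc]
      simp [hc0]
    exact_mod_cast h0
  | succ n ih =>
    have hγ₀ : γ.IsNonZero := fun h0 ↦ hp <| by
      have := hγ.symm
      rw [h0.eq, Pi.zero_apply] at this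
      exact_mod_cast this
    obtain ⟨i, hi, hbot⟩ := exists_one_le_chainBotCoeff_of_eq_sum ha hγ₀ c hc
    intro z hz
    obtain ⟨e, he, y, hy, rfl⟩ := exists_lie_eq_of_one_le_chainBotCoeff (ha i) hγ₀ hbot hz
    rcases had i with h0 | h1
    · refine lie_mem_lieSpan (rootSpace_le (by simp [h0]) he) ?_
      by_cases hδ : rootSpace H (-⇑(a i) + ⇑γ) = ⊥
      · rw [hδ, LieSubmodule.mem_bot] at hy
        simp [hy]
      · have hsum : ∑ j, c j = ∑ j, (Function.update c i (c i - 1)) j + 1 := by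
          rw [Finset.sum_update_of_mem (Finset.mem_univ i),
            ← Finset.add_sum_erase _ _ (Finset.mem_univ i), Finset.sdiff_singleton_eq_erase]
          lia
        refine ih (Function.update c i (c i - 1)) (by lia) ⟨_, hδ⟩ ?_ (fun h ↦ ?_) hy
        · change -(a i d) + γ d = _
          rw [h0, hγ, neg_zero, zero_add]
        · change -(a i h) + γ h = _
          rw [hc, ← Finset.add_sum_erase _ _ (Finset.mem_univ i),
            ← Finset.add_sum_erase (a := i) _ _ (Finset.mem_univ i)]
          have : ∀ j ∈ Finset.univ.erase i, ((Function.update c i (c i - 1) j : ℕ) : ℂ) * a j h =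
              c j * a j h := fun j hj ↦ by
            rw [Function.update_of_ne (Finset.ne_of_mem_erase hj)]
          rw [Finset.sum_congr rfl this, Function.update_self, Nat.cast_sub hi]
          push_cast
          ring
    · refine Submodule.subset_span ⟨e, rootSpace_le h1 he, y, rootSpace_le ?_ hy, rfl⟩
      simp [h1, hγ]

lemma eq_lieSpan {ι : Type*} [Fintype ι] {a : ι → Weight ℂ H L}
    (ha : ∀ i, (a i).IsNonZero) {s p : ℤ} (hp : s + p ≠ 0)
    (had : ∀ i, a i d = 0 ∨ a i d = s)
    (h : ∀ γ : Weight ℂ H L, γ.IsNonZero → γ d = (s + p : ℤ) →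
      ∃ c : ι → ℕ, ∀ h, γ h = ∑ i, (c i : ℂ) * a i h) :
    gradePiece L H d (s + p) = lieSpan d s p := by
  refine le_antisymm ?_ (lieSpan_le s p)
  rw [gradePiece, if_neg hp, bot_sup_eq]
  refine iSup_le fun ⟨γ, hγ₀, hγ⟩ ↦ ?_
  obtain ⟨c, hc⟩ := h γ hγ₀ hγ
  exact rootSpace_le_lieSpan ha hp had _ c rfl γ hγ hc

end gradePiece

/-- Let `L` be a finite-dimensional complex semisimple Lie algebra with Cartan
subalgebra `H`, root system the set of nonzero weights of the adjoint action of `H`, and let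
`S` be a base (system of simple roots) of the root system.  If `d ∈ H` satisfies
`α d ∈ {0, 1}` for every simple root `α ∈ S`, then the subspaces `𝔤_p = gradePiece L H d p`
form a ℤ-gradation `L = ⨁_{p ∈ ℤ} 𝔤_p`, i.e. `⁅𝔤_p, 𝔤_q⁆ ⊆ 𝔤_{p+q}`, and this gradation is
fundamental: `𝔤_{p+1} = ⁅𝔤_1, 𝔤_p⁆` and `𝔤_{-p-1} = ⁅𝔤_{-1}, 𝔤_{-p}⁆` for all `p ≥ 1`. -/
theorem gradePiece_isInternal_and_fundamental
    (L : Type*) [LieRing L] [LieAlgebra ℂ L] [FiniteDimensional ℂ L]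
    [LieAlgebra.IsSemisimple ℂ L]
    (H : LieSubalgebra ℂ L) [H.IsCartanSubalgebra]
    (S : Finset (LieModule.Weight ℂ H L))
    (hSroot : ∀ α ∈ S, α.IsNonZero)
    -- `S` is a base: every root is a linear combination of elements of `S` with integer
    -- coefficients, all nonnegative or all nonpositive
    (hbase : ∀ α : LieModule.Weight ℂ H L, α.IsNonZero →
      ∃ c : S → ℤ, ((∀ i, 0 ≤ c i) ∨ (∀ i, c i ≤ 0)) ∧
        ∀ h : H, α h = ∑ i : S, (c i : ℂ) * (i : LieModule.Weight ℂ H L) h)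
    (d : H)
    (hd : ∀ α ∈ S, α d = 0 ∨ α d = 1) :
    (∀ p q : ℤ, ∀ x ∈ gradePiece L H d p, ∀ y ∈ gradePiece L H d q,
        ⁅x, y⁆ ∈ gradePiece L H d (p + q)) ∧
    DirectSum.IsInternal (gradePiece L H d) ∧
    (∀ p : ℤ, 1 ≤ p →
      gradePiece L H d (p + 1) =
        Submodule.span ℂ
          {z : L | ∃ x ∈ gradePiece L H d 1, ∃ y ∈ gradePiece L H d p, z = ⁅x, y⁆} ∧
      gradePiece L H d (-(p + 1)) =
        Submodule.span ℂ
          {z : L | ∃ x ∈ gradePiece L H d (-1), ∃ y ∈ gradePiece L H d (-p), z = ⁅x, y⁆}) := by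
  have _ : LieAlgebra.IsKilling ℂ L := inferInstance
  have key (α : LieModule.Weight ℂ H L) (c : S → ℤ)
      (hc : ∀ h : H, α h = ∑ i : S, (c i : ℂ) * (i : LieModule.Weight ℂ H L) h) :
      ∃ e : S → ℤ, (∀ i, 0 ≤ e i) ∧ α d = (∑ i, c i * e i : ℤ) := by
    choose e he using fun i : S ↦ (show ∃ n : ℤ, 0 ≤ n ∧
      (i : LieModule.Weight ℂ H L) d = n from
        (hd i i.2).elim (fun h ↦ ⟨0, by simp [h]⟩) (fun h ↦ ⟨1, by simp [h]⟩))
    exact ⟨e, fun i ↦ (he i).1, by simp [hc, (he _).2]⟩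
  refine ⟨fun p q x hx y hy ↦ gradePiece.lie_mem hx hy,
    gradePiece.isInternal fun α hα ↦ ?_, fun p hp ↦ ⟨?_, ?_⟩⟩
  · obtain ⟨c, -, hc⟩ := hbase α hα
    obtain ⟨e, -, he⟩ := key α c hc
    exact ⟨_, he⟩
  · rw [add_comm]
    refine gradePiece.eq_lieSpan (a := fun i : S ↦ (i : LieModule.Weight ℂ H L))
      (fun i ↦ hSroot i i.2) (by lia) (fun i ↦ by simpa using hd i i.2) fun γ hγ₀ hγ ↦ ?_
    obtain ⟨c, hc | hc, hsum⟩ := hbase γ hγ₀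
    · lift c to S → ℕ using hc
      exact ⟨c, by simpa using hsum⟩
    · obtain ⟨e, he₀, he⟩ := key γ c hsum
      have hle : ∑ i, c i * e i ≤ 0 :=
        Finset.sum_nonpos fun i _ ↦ mul_nonpos_of_nonpos_of_nonneg (hc i) (he₀ i)
      have := Int.cast_injective (hγ.symm.trans he)
      lia
  · rw [neg_add_rev]
    refine gradePiece.eq_lieSpan (a := fun i : S ↦ -(i : LieModule.Weight ℂ H L))
      (fun i ↦ (hSroot i i.2).neg) (by lia)
      (fun i ↦ by simpa [neg_eq_iff_eq_neg] using hd i i.2) fun γ hγ₀ hγ ↦ ?_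
    obtain ⟨c, hc | hc, hsum⟩ := hbase γ hγ₀
    · obtain ⟨e, he₀, he⟩ := key γ c hsum
      have hle : 0 ≤ ∑ i, c i * e i :=
        Finset.sum_nonneg fun i _ ↦ mul_nonneg (hc i) (he₀ i)
      have := Int.cast_injective (hγ.symm.trans he)
      lia
    · obtain ⟨b, rfl⟩ : ∃ b : S → ℕ, c = fun i ↦ -(b i : ℤ) :=
        ⟨fun i ↦ (c i).natAbs, funext fun i ↦ by have := hc i; lia⟩
      exact ⟨b, by simpa using hsum⟩
end

section
/- Let 𝔤 be a finite-dimensional complex semisimple Lie algebra with Cartan subalgebra 𝔞, root system R, root spaces 𝔤_α and Killing form B. Let ξ : 𝔤 → ℂ be a linear form which vanishes on every root space 𝔤_α, α ∈ R. Then the radical of the skew-symmetric bilinear form dξ(X,Y) := ξ([X,Y]) on 𝔤 equals 𝔞 ⊕ ⨁_{α∈R, ξ(t_α)=0} 𝔤_α, where for each root α, t_α ∈ 𝔞 is the unique element satisfying B(t_α, h) = α(h) for all h ∈ 𝔞. -/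
open LieAlgebra LieModule LieAlgebra.IsKilling

section LinearForm

variable {K L : Type*} [Field K] [LieRing L] [LieAlgebra K L]
  {H : LieSubalgebra K L} [H.IsCartanSubalgebra]

/-- A linear form vanishing on all root spaces kills brackets of vectors in the generalized
root spaces of `χ₁` and `χ₂` when `χ₁ + χ₂ ≠ 0`. -/
lemma apply_lie_eq_zero_of_add_ne_zero (ξ : Module.Dual K L)
    (hξ : ∀ α : Weight K H L, α.IsNonZero → ∀ x ∈ rootSpace H (α : H → K), ξ x = 0)
    {χ₁ χ₂ : H → K} (h : χ₁ + χ₂ ≠ 0) {x y : L}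
    (hx : x ∈ rootSpace H χ₁) (hy : y ∈ rootSpace H χ₂) : ξ ⁅x, y⁆ = 0 := by
  have hxy : ⁅x, y⁆ ∈ rootSpace H (χ₁ + χ₂) :=
    mapsTo_toEnd_genWeightSpace_add_of_mem_rootSpace K L H L χ₁ χ₂ hx hy
  by_cases hbot : rootSpace H (χ₁ + χ₂) = ⊥
  · rw [hbot, LieSubmodule.mem_bot] at hxy
    rw [hxy, map_zero]
  · exact hξ ⟨χ₁ + χ₂, hbot⟩ h _ hxy

/-- To show that all brackets with `x` in the generalized root space of `χ` are killed by `ξ`,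
it suffices to consider the generalized root space of `-χ`. -/
lemma apply_lie_eq_zero_of_forall_rootSpace_neg [FiniteDimensional K L] [IsTriangularizable K H L]
    (ξ : Module.Dual K L)
    (hξ : ∀ α : Weight K H L, α.IsNonZero → ∀ x ∈ rootSpace H (α : H → K), ξ x = 0)
    {χ : H → K} {x : L} (hx : x ∈ rootSpace H χ)
    (hneg : ∀ y ∈ rootSpace H (-χ), ξ ⁅x, y⁆ = 0) (y : L) : ξ ⁅x, y⁆ = 0 := by
  have hy : y ∈ ⨆ β, rootSpace H β := by simp [iSup_genWeightSpace_eq_top K H L]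
  induction hy using LieSubmodule.iSup_induction' with
  | mem β y hy =>
    by_cases hβ : χ + β = 0
    · exact hneg _ (add_eq_zero_iff_neg_eq.mp hβ ▸ hy)
    · exact apply_lie_eq_zero_of_add_ne_zero ξ hξ hβ hx hy
  | zero => simp
  | add y z _ _ hy hz => simp [hy, hz]

/-- An element `t` of the Cartan subalgebra dual to the root `α` computes brackets of opposite
root vectors. -/
lemma lie_eq_killingForm_smul_of_dual [FiniteDimensional K L] [IsKilling K L] [PerfectField K]
    [IsTriangularizable K H L]
    {α : Weight K H L} {t : H} (ht : ∀ h : H, killingForm K L (t : L) (h : L) = α h)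
    {x y : L} (hx : x ∈ rootSpace H α) (hy : y ∈ rootSpace H (-α : H → K)) :
    ⁅x, y⁆ = killingForm K L x y • (t : L) := by
  have h : t = (cartanEquivDual H).symm α.toLinear := by
    rw [LinearEquiv.eq_symm_apply]
    ext h
    exact ht h
  rw [h]
  exact lie_eq_killingForm_smul_of_mem_rootSpace_of_mem_rootSpace_neg hx hy

end LinearForm

/-- Let `L` be a finite-dimensional complex semisimple Lie algebra with Cartan
subalgebra `H`, roots the nonzero weights of the adjoint action of `H` with root spaces
`LieAlgebra.rootSpace H α`, and Killing form `B`.  Let `ξ : L → ℂ` be a linear form vanishing on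
every root space.  For each root `α` let `tα α ∈ H` be the (unique) element with
`B (tα α) h = α h` for all `h ∈ H`.  Then the radical of the skew-symmetric bilinear form
`dξ (X, Y) := ξ ⁅X, Y⁆` equals `H ⊕ ⨁_{α root, ξ (tα α) = 0} 𝔤_α`. -/
theorem radical_dxi_eq
    (L : Type*) [LieRing L] [LieAlgebra ℂ L] [FiniteDimensional ℂ L]
    [LieAlgebra.IsSemisimple ℂ L]
    (H : LieSubalgebra ℂ L) [H.IsCartanSubalgebra]
    (ξ : Module.Dual ℂ L)
    (hξroot : ∀ α : LieModule.Weight ℂ H L, α.IsNonZero →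
      ∀ x ∈ LieAlgebra.rootSpace H (α : H → ℂ), ξ x = 0)
    (tα : LieModule.Weight ℂ H L → H)
    (htα : ∀ (α : LieModule.Weight ℂ H L) (h : H),
      killingForm ℂ L (tα α : L) (h : L) = α h) :
    {X : L | ∀ Y : L, ξ ⁅X, Y⁆ = 0} =
      ↑(H.toSubmodule ⊔
        ⨆ α : {α : LieModule.Weight ℂ H L // α.IsNonZero ∧ ξ (tα α : L) = 0},
          (LieAlgebra.rootSpace H (α : H → ℂ)).toSubmodule) := by
  apply Set.Subset.antisymm
  · intro X hX
    have hXtop : X ∈ ⨆ α : Weight ℂ H L, (rootSpace H (α : H → ℂ)).toSubmodule := by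
      rw [← LieSubmodule.iSup_toSubmodule, iSup_genWeightSpace_eq_top']
      exact Submodule.mem_top
    obtain ⟨f, hf, rfl⟩ := (Submodule.mem_iSup_iff_exists_finsupp _ _).mp hXtop
    refine Submodule.sum_mem _ fun α _ ↦ ?_
    by_cases hα : α.IsZero
    · refine Submodule.mem_sup_left ?_
      have h := hf α
      rw [hα] at h
      simpa using h
    by_cases hξα : ξ (tα α : L) = 0
    · exact Submodule.mem_sup_right (Submodule.mem_iSup_of_mem ⟨α, hα, hξα⟩ (hf α))
    suffices h : f α ∈ LinearMap.ker (killingForm ℂ L) by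
      rw [ker_killingForm_eq_bot, Submodule.mem_bot] at h
      rw [h]
      exact Submodule.zero_mem _
    refine mem_ker_killingForm_of_mem_rootSpace_of_forall_rootSpace_neg ℂ L H (hf α) fun y hy ↦ ?_
    have hsum : ξ ⁅f.sum fun _ x ↦ x, y⁆ = ξ ⁅f α, y⁆ := by
      rw [Finsupp.sum, sum_lie, map_sum]
      refine Finset.sum_eq_single α (fun β _ hβ ↦ ?_) fun h ↦ ?_
      · refine apply_lie_eq_zero_of_add_ne_zero ξ hξroot (fun h ↦ hβ ?_) (hf β) hy
        exact DFunLike.coe_injective (by simpa [add_neg_eq_zero] using h)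
      · simp [Finsupp.notMem_support_iff.mp h]
    have h0 := hX y
    rw [hsum, lie_eq_killingForm_smul_of_dual (htα α) (hf α) hy, map_smul, smul_eq_mul] at h0
    exact (mul_eq_zero.mp h0).resolve_right hξα
  · let N : Submodule ℂ L :=
      { carrier := {X : L | ∀ Y : L, ξ ⁅X, Y⁆ = 0}
        add_mem' := fun hx hy Y ↦ by rw [add_lie, map_add, hx Y, hy Y, add_zero]
        zero_mem' := fun Y ↦ by simp
        smul_mem' := fun c x hx Y ↦ by rw [smul_lie, map_smul, hx Y, smul_zero] }
    change _ ≤ N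
    refine sup_le (fun x hx ↦ ?_) (iSup_le fun α x hx ↦ ?_)
    · have hx0 : x ∈ rootSpace H (0 : H → ℂ) := by simpa using hx
      refine apply_lie_eq_zero_of_forall_rootSpace_neg ξ hξroot hx0 fun y hy ↦ ?_
      have hyH : y ∈ H := by simpa using hy
      have h : ⁅(⟨x, hx⟩ : H), (⟨y, hyH⟩ : H)⁆ = 0 := trivial_lie_zero _ _ _ _
      have h' : ⁅x, y⁆ = 0 := congrArg Subtype.val h
      rw [h', map_zero]
    · refine apply_lie_eq_zero_of_forall_rootSpace_neg ξ hξroot hx fun y hy ↦ ?_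
      rw [lie_eq_killingForm_smul_of_dual (htα α) hx hy, map_smul, α.2.2, smul_zero]
end

section
/- Let L be a Lie algebra over a commutative ring and K : L → L a linear map with K ∘ K = id whose Nijenhuis tensor N_K(X,Y) := [X,Y] + [KX,KY] − K[KX,Y] − K[X,KY] vanishes identically. Then [X,Y]_K := [KX,Y] + [X,KY] − K[X,Y] is a Lie bracket on L (bilinear, alternating and satisfying the Jacobi identity), and K is a Lie algebra homomorphism from (L, [·,·]_K) to (L, [·,·]), i.e. K([X,Y]_K) = [KX, KY] for all X, Y ∈ L. -/
/-- Let `L` be a Lie algebra over a commutative ring `R` and `K : L → L` a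
linear map with `K ∘ K = id` whose Nijenhuis tensor
`N_K (X, Y) = ⁅X, Y⁆ + ⁅K X, K Y⁆ − K ⁅K X, Y⁆ − K ⁅X, K Y⁆` vanishes identically.  Then
`⁅X, Y⁆_K := ⁅K X, Y⁆ + ⁅X, K Y⁆ − K ⁅X, Y⁆` is a Lie bracket on `L` (bilinear, alternating
and satisfying the Jacobi identity), and `K` is a Lie algebra homomorphism from
`(L, ⁅·,·⁆_K)` to `(L, ⁅·,·⁆)`, i.e. `K ⁅X, Y⁆_K = ⁅K X, K Y⁆`. -/
theorem deformed_bracket_is_lie_bracket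
    (R : Type*) [CommRing R]
    (L : Type*) [LieRing L] [LieAlgebra R L]
    (K : L →ₗ[R] L)
    (hK2 : K ∘ₗ K = LinearMap.id)
    (hN : ∀ X Y : L, ⁅X, Y⁆ + ⁅K X, K Y⁆ - K ⁅K X, Y⁆ - K ⁅X, K Y⁆ = 0)
    (br : L → L → L)
    (hbr : ∀ X Y : L, br X Y = ⁅K X, Y⁆ + ⁅X, K Y⁆ - K ⁅X, Y⁆) :
    (∀ (a : R) (X X' Y : L), br (a • X + X') Y = a • br X Y + br X' Y) ∧
    (∀ (a : R) (X Y Y' : L), br X (a • Y + Y') = a • br X Y + br X Y') ∧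
    (∀ X : L, br X X = 0) ∧
    (∀ X Y Z : L, br (br X Y) Z + br (br Y Z) X + br (br Z X) Y = 0) ∧
    (∀ X Y : L, K (br X Y) = ⁅K X, K Y⁆) := by
  have hKK (X : L) : K (K X) = X := LinearMap.congr_fun hK2 X
  have hom (X Y : L) : K (br X Y) = ⁅K X, K Y⁆ := by
    rw [hbr, map_sub, map_add, hKK, ← sub_eq_zero, ← neg_eq_zero, ← hN X Y]
    abel
  -- The deformed bracket is the original one transported along the involution `K`.
  have br_eq (X Y : L) : br X Y = K ⁅K X, K Y⁆ := by rw [← hom, hKK]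
  refine ⟨fun a X X' Y => ?_, fun a X Y Y' => ?_, fun X => ?_, fun X Y Z => ?_, hom⟩
  · simp [br_eq]
  · simp [br_eq]
  · simp [br_eq]
  · have jacobi := lie_jacobi (K Z) (K X) (K Y)
    rw [← lie_skew (K Z), ← lie_skew (K X) ⁅K Y, K Z⁆, ← lie_skew (K Y) ⁅K Z, K X⁆,
      ← neg_add, ← neg_add, neg_eq_zero] at jacobi
    simp only [br_eq, hKK]
    rw [← map_add, ← map_add, jacobi, map_zero]
end

section
/- In ℝ^{ℓ+1} with standard orthonormal basis ε_1, …, ε_{ℓ+1}, consider the root system of type A_ℓ with roots ε_i − ε_j (i ≠ j), simple roots α_i = ε_i − ε_{i+1} (1 ≤ i ≤ ℓ), positive roots R⁺ = {ε_i − ε_j : i < j}, and fundamental weights π_m = Σ_{j=1}^m ε_j − (m/(ℓ+1)) Σ_{j=1}^{ℓ+1} ε_j. Fix integers 0 = i_0 < i_1 < ⋯ < i_r < i_{r+1} = ℓ + 1 and let R₀⁺ be the set of positive roots ε_i − ε_j such that i and j lie in the same interval (i_{k−1}, i_k] for some k ∈ {1, …, r+1}. Then 2( Σ_{α ∈ R⁺}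 α − Σ_{α ∈ R₀⁺} α ) = 2 Σ_{k=1}^{r} (i_{k+1} − i_{k−1}) π_{i_k}. -/
open scoped Classical

/-- The `t`-th coordinate of a sum of vectors `e_i - e_j` counts the pairs starting at `t` minus
the pairs ending at `t`. -/
lemma sum_single_sub_single_apply {n : ℕ} (P : Fin n × Fin n → Prop) [DecidablePred P]
    (t : Fin n) :
    (∑ p ∈ Finset.univ.filter P,
      ((Pi.single p.1 1 : Fin n → ℝ) - Pi.single p.2 1) : Fin n → ℝ) t =
      (∑ j, if P (t, j) then (1 : ℝ) else 0) - ∑ i, if P (i, t) then (1 : ℝ) else 0 := by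
  simp only [Finset.sum_apply, Pi.sub_apply, Finset.sum_sub_distrib, Finset.sum_filter,
    Pi.single_apply]
  congr 1
  · rw [Fintype.sum_prod_type, Finset.sum_comm]
    refine Finset.sum_congr rfl fun j _ => ?_
    rw [Finset.sum_eq_single t] <;> simp +contextual [eq_comm]
  · rw [Fintype.sum_prod_type]
    refine Finset.sum_congr rfl fun i _ => ?_
    rw [Finset.sum_eq_single t] <;> simp +contextual [eq_comm]

lemma sum_fin_ite_lt {n m : ℕ} (h : m ≤ n) :
    (∑ j : Fin n, if (j : ℕ) < m then (1 : ℝ) else 0) = m := by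
  rw [Finset.sum_boole, Fin.card_filter_val_lt, min_eq_right h]

lemma sum_fin_ite_ge {n m : ℕ} (h : m ≤ n) :
    (∑ j : Fin n, if m ≤ (j : ℕ) then (1 : ℝ) else 0) = n - m := by
  rw [eq_sub_iff_add_eq, ← sum_fin_ite_lt h, ← Finset.sum_add_distrib]
  calc _ = ∑ _j : Fin n, (1 : ℝ) :=
        Finset.sum_congr rfl fun j _ => by split_ifs <;> first | omega | simp
    _ = n := by simp

/-- Every natural number below `a (r + 1)` lies in one of the blocks cut out by `a`. -/
lemma exists_block (a : ℕ → ℕ) (h0 : a 0 = 0) (r t : ℕ) (ht : t < a (r + 1)) :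
    ∃ k ≤ r, a k ≤ t ∧ t < a (k + 1) := by
  induction r with
  | zero => exact ⟨0, le_rfl, by omega, ht⟩
  | succ r ih =>
    by_cases h : t < a (r + 1)
    · obtain ⟨k, hk, hk'⟩ := ih h
      exact ⟨k, by omega, hk'⟩
    · exact ⟨r + 1, le_rfl, by omega, ht⟩

lemma le_of_forall_lt_succ {a : ℕ → ℕ} {r : ℕ} (h : ∀ k ≤ r, a k < a (k + 1)) {i j : ℕ}
    (hij : i ≤ j) (hj : j ≤ r + 1) : a i ≤ a j := by
  induction j, hij using Nat.le_induction with
  | base => exact le_rfl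
  | succ j _ ih => exact (ih (by omega)).trans (h j (by omega)).le

lemma sum_telescope_add (a : ℕ → ℝ) {K r : ℕ} (h : K ≤ r) :
    (∑ k ∈ Finset.range r, (a (k + 2) - a k) * if K ≤ k then 1 else 0) =
      a (r + 1) + a r - a (K + 1) - a K := by
  induction r, h using Nat.le_induction with
  | base =>
    rw [Finset.sum_eq_zero fun k hk => by
      rw [if_neg (not_le.mpr (Finset.mem_range.mp hk)), mul_zero]]
    ring
  | succ r hr ih => rw [Finset.sum_range_succ, ih, if_pos hr]; ring

lemma sum_telescope_mul (a : ℕ → ℝ) (r : ℕ) :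
    (∑ k ∈ Finset.range r, (a (k + 2) - a k) * a (k + 1)) = a (r + 1) * a r - a 1 * a 0 := by
  induction r with
  | zero => simp
  | succ r ih => rw [Finset.sum_range_succ, ih]; ring

/-- In `ℝ^{ℓ+1}` with standard basis `ε_0, …, ε_ℓ` consider the root
system of type `A_ℓ` with positive roots `ε_i − ε_j` (`i < j`) and fundamental weights
`π_m = Σ_{j < m} ε_j − (m/(ℓ+1)) Σ_j ε_j`.  Fix `0 = i_0 < i_1 < ⋯ < i_{r+1} = ℓ+1` and let
`R₀⁺` be the set of positive roots `ε_i − ε_j` with `i, j` in the same block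
`[i_{k-1}, i_k)`.  Then `2(Σ_{α ∈ R⁺} α − Σ_{α ∈ R₀⁺} α) = 2 Σ_{k=1}^{r} (i_{k+1} − i_{k−1}) π_{i_k}`. -/
theorem koszul_form_A_ell
    (ℓ r : ℕ)
    (idx : ℕ → ℕ) (h0 : idx 0 = 0) (hlast : idx (r + 1) = ℓ + 1)
    (hmono : ∀ k ≤ r, idx k < idx (k + 1))
    (ε : Fin (ℓ + 1) → Fin (ℓ + 1) → ℝ) (hε : ∀ j, ε j = Pi.single j 1)
    (fw : ℕ → Fin (ℓ + 1) → ℝ)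
    (hfw : ∀ m : ℕ, fw m =
      (∑ j ∈ Finset.univ.filter (fun j : Fin (ℓ + 1) => (j : ℕ) < m), ε j) -
        ((m : ℝ) / ((ℓ : ℝ) + 1)) • ∑ j : Fin (ℓ + 1), ε j) :
    (2 : ℝ) •
        ((∑ p ∈ Finset.univ.filter (fun p : Fin (ℓ + 1) × Fin (ℓ + 1) => p.1 < p.2),
            (ε p.1 - ε p.2)) -
          ∑ p ∈ Finset.univ.filter (fun p : Fin (ℓ + 1) × Fin (ℓ + 1) => p.1 < p.2 ∧
              ∃ k ∈ Finset.range (r + 1),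
                idx k ≤ (p.1 : ℕ) ∧ (p.1 : ℕ) < idx (k + 1) ∧
                idx k ≤ (p.2 : ℕ) ∧ (p.2 : ℕ) < idx (k + 1)),
            (ε p.1 - ε p.2)) =
      (2 : ℝ) • ∑ k ∈ Finset.range r,
        (((idx (k + 2) : ℝ)) - ((idx k : ℝ))) • fw (idx (k + 1)) := by
  obtain rfl : ε = fun j => Pi.single j 1 := funext hε
  congr 1
  funext t
  obtain ⟨K, hK, hKt, htK⟩ := exists_block idx h0 r t (by have := t.2; omega)
  have mono : ∀ {i j : ℕ}, i ≤ j → j ≤ r + 1 → idx i ≤ idx j :=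
    fun h h' => le_of_forall_lt_succ hmono h h'
  have block : ∀ k < r + 1, ∀ s : ℕ, idx k ≤ s → s < idx (k + 1) →
      idx K ≤ s → s < idx (K + 1) → k = K := by
    intro k hk s h1 h2 h3 h4
    rcases lt_trichotomy k K with h | h | h
    · have := mono (i := k + 1) (j := K) h (by omega)
      omega
    · exact h
    · have := mono (i := K + 1) (j := k) h (by omega)
      omega
  have hfwt : ∀ k ∈ Finset.range r, fw (idx (k + 1)) t =
      (if K ≤ k then (1 : ℝ) else 0) - idx (k + 1) / ((ℓ : ℝ) + 1) := by
    intro k hk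
    have hk := Finset.mem_range.mp hk
    have hiff : (t : ℕ) < idx (k + 1) ↔ K ≤ k := by
      constructor
      · intro h
        by_contra hlt
        have := mono (i := k + 1) (j := K) (by omega) (by omega)
        omega
      · intro h
        have := mono (i := K + 1) (j := k + 1) (by omega) (by omega)
        omega
    simp only [hfw, Pi.sub_apply, Pi.smul_apply, Finset.sum_apply, Pi.single_apply,
      Finset.sum_ite_eq, Finset.mem_filter, Finset.mem_univ, true_and, hiff, if_true,
      smul_eq_mul, mul_one]
  have hright : (∑ k ∈ Finset.range r,
      (((idx (k + 2) : ℝ)) - ((idx k : ℝ))) • fw (idx (k + 1))) t =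
      (ℓ : ℝ) + 1 - idx (K + 1) - idx K := by
    have hlastR : (idx (r + 1) : ℝ) = (ℓ : ℝ) + 1 := by rw [hlast]; push_cast; ring
    have hne : (ℓ : ℝ) + 1 ≠ 0 := by positivity
    rw [Finset.sum_apply]
    simp only [Pi.smul_apply, smul_eq_mul]
    rw [Finset.sum_congr rfl fun k hk => by rw [hfwt k hk, mul_sub, ← mul_div_assoc],
      Finset.sum_sub_distrib, ← Finset.sum_div, sum_telescope_add (fun k => (idx k : ℝ)) hK,
      sum_telescope_mul (fun k => (idx k : ℝ)), hlastR, h0]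
    field_simp
    ring
  have hle : idx (K + 1) ≤ ℓ + 1 := hlast ▸ mono (by omega) le_rfl
  beta_reduce
  rw [hright, Pi.sub_apply, sum_single_sub_single_apply, sum_single_sub_single_apply,
    sub_sub_sub_comm, ← Finset.sum_sub_distrib, ← Finset.sum_sub_distrib]
  have hout := sum_fin_ite_ge hle
  have hin := sum_fin_ite_lt (n := ℓ + 1) (m := idx K) (by omega)
  push_cast at hout
  rw [← hout, ← hin]
  congr 1
  · refine Finset.sum_congr rfl fun j _ => ?_
    have hiff : (t < j ∧ ∃ k ∈ Finset.range (r + 1), idx k ≤ (t : ℕ) ∧ (t : ℕ) < idx (k + 1) ∧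
        idx k ≤ (j : ℕ) ∧ (j : ℕ) < idx (k + 1)) ↔ t < j ∧ (j : ℕ) < idx (K + 1) := by
      refine and_congr_right fun h => ⟨?_, fun h' => ⟨K, by simp; omega, hKt, htK, ?_, h'⟩⟩
      · rintro ⟨k, hk, h1, h2, -, h4⟩
        rwa [← block k (Finset.mem_range.mp hk) t h1 h2 hKt htK]
      · have : (t : ℕ) < j := h
        omega
    simp only [Fin.lt_def] at hiff ⊢
    split_ifs <;> grind
  · refine Finset.sum_congr rfl fun i _ => ?_
    have hiff : (i < t ∧ ∃ k ∈ Finset.range (r + 1), idx k ≤ (i : ℕ) ∧ (i : ℕ) < idx (k + 1) ∧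
        idx k ≤ (t : ℕ) ∧ (t : ℕ) < idx (k + 1)) ↔ i < t ∧ idx K ≤ (i : ℕ) := by
      refine and_congr_right fun h => ⟨?_, fun h' => ⟨K, by simp; omega, h', ?_, hKt, htK⟩⟩
      · rintro ⟨k, hk, h1, -, h3, h4⟩
        rwa [← block k (Finset.mem_range.mp hk) t h3 h4 hKt htK]
      · have : (i : ℕ) < t := h
        omega
    simp only [Fin.lt_def] at hiff ⊢
    split_ifs <;> grind
end
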